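/- Let s and t be pseudo-secondary structures on n positions with |s| < |t|, and set k = |t| − |s| ≥ 1. Then dg(s) > dg(t), unless k = 1 and 2|t| = n, in which case dg(s) = dg(t). -/

import Mathlib

/-- A pseudo-secondary structure on `n` positions: a partial matching on
`{1,…,n}`, i.e. a set of pairs `(i,j)` with `1 ≤ i < j ≤ n` in which no
position occurs in more than one pair (crossings allowed, θ = 0). -/
def IsPseudo (n : ℕ) (s : Finset (ℕ × ℕ)) : Prop :=
  (∀ p ∈ s, 1 ≤ p.1 ∧ p.1 < p.2 ∧ p.2 ≤ n) ∧
  (∀ p ∈ s, ∀ q ∈ s, p ≠ q →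
    p.1 ≠ q.1 ∧ p.1 ≠ q.2 ∧ p.2 ≠ q.1 ∧ p.2 ≠ q.2)

/-- `t` is obtained from `s` by adding or removing exactly one pair. -/
def Neighbor (s t : Finset (ℕ × ℕ)) : Prop :=
  (∃ p, p ∉ s ∧ t = insert p s) ∨ (∃ p, p ∈ s ∧ t = s.erase p)

/-- The degree `dg` of a pseudo-secondary structure `s` on `n` positions:
the number of pseudo-secondary structures on `n` positions obtainable from
`s` by adding or removing exactly one pair. -/
noncomputable def dg (n : ℕ) (s : Finset (ℕ × ℕ)) : ℕ :=
  Set.ncard {t : Finset (ℕ × ℕ) | IsPseudo n t ∧ Neighbor s t}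

/-- Unpaired positions. -/
def freePos (n : ℕ) (s : Finset (ℕ × ℕ)) : Finset ℕ :=
  Finset.Icc 1 n \ (s.image Prod.fst ∪ s.image Prod.snd)

/-- Pairs that may be added. -/
def freePairs (n : ℕ) (s : Finset (ℕ × ℕ)) : Finset (ℕ × ℕ) :=
  (freePos n s ×ˢ freePos n s).filter (fun p => p.1 < p.2)

theorem card_freePos (n : ℕ) (s : Finset (ℕ × ℕ)) (hs : IsPseudo n s) :
    (freePos n s).card + 2 * s.card = n := by
  obtain ⟨h1, h2⟩ := hs
  have hsub : (s.image Prod.fst ∪ s.image Prod.snd) ⊆ Finset.Icc 1 n := by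
    intro x hx
    simp only [Finset.mem_union, Finset.mem_image] at hx
    rw [Finset.mem_Icc]
    rcases hx with ⟨p, hp, rfl⟩ | ⟨p, hp, rfl⟩
    · have := h1 p hp
      omega
    · have := h1 p hp
      omega
  have hd : Disjoint (s.image Prod.fst) (s.image Prod.snd) := by
    rw [Finset.disjoint_left]
    intro x hx hy
    simp only [Finset.mem_image] at hx hy
    obtain ⟨p, hp, rfl⟩ := hx
    obtain ⟨q, hq, hpq⟩ := hy
    by_cases e : p = q
    · subst e
      have := h1 p hp
      omega
    · exact (h2 p hp q hq e).2.1 hpq.symm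
  have c1 : (s.image Prod.fst).card = s.card := by
    apply Finset.card_image_of_injOn
    intro p hp q hq e
    by_contra hne
    exact (h2 p hp q hq hne).1 e
  have c2 : (s.image Prod.snd).card = s.card := by
    apply Finset.card_image_of_injOn
    intro p hp q hq e
    by_contra hne
    exact (h2 p hp q hq hne).2.2.2 e
  have c3 := Finset.card_sdiff_add_card_eq_card hsub
  rw [Finset.card_union_of_disjoint hd, c1, c2, Nat.card_Icc] at c3
  unfold freePos
  omega

theorem card_ltPairs (U : Finset ℕ) :
    2 * ((U ×ˢ U).filter (fun p => p.1 < p.2)).card + U.card = U.card * U.card := by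
  have e : U.offDiag = (U ×ˢ U).filter (fun p => p.1 < p.2) ∪
      ((U ×ˢ U).filter (fun p => p.1 < p.2)).image Prod.swap := by
    ext ⟨a, b⟩
    simp only [Finset.mem_offDiag, Finset.mem_union, Finset.mem_filter, Finset.mem_product,
      Finset.mem_image, Prod.exists, Prod.swap_prod_mk, Prod.mk.injEq]
    constructor
    · rintro ⟨ha, hb, hab⟩
      rcases lt_or_gt_of_ne hab with h | h
      · exact Or.inl ⟨⟨ha, hb⟩, h⟩
      · exact Or.inr ⟨b, a, ⟨⟨hb, ha⟩, h⟩, rfl, rfl⟩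
    · rintro (⟨⟨ha, hb⟩, h⟩ | ⟨c, d, ⟨⟨hc, hd⟩, h⟩, rfl, rfl⟩)
      · exact ⟨ha, hb, by omega⟩
      · exact ⟨hd, hc, by omega⟩
  have d : Disjoint ((U ×ˢ U).filter (fun p => p.1 < p.2))
      (((U ×ˢ U).filter (fun p => p.1 < p.2)).image Prod.swap) := by
    rw [Finset.disjoint_left]
    rintro ⟨a, b⟩ hx hy
    simp only [Finset.mem_filter, Finset.mem_product,
      Finset.mem_image, Prod.exists, Prod.swap_prod_mk, Prod.mk.injEq] at hx hy
    obtain ⟨c, d, ⟨_, h⟩, rfl, rfl⟩ := hy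
    omega
  have c := Finset.offDiag_card U
  rw [e, Finset.card_union_of_disjoint d,
    Finset.card_image_of_injective _ Prod.swap_injective] at c
  have : U.card ≤ U.card * U.card := Nat.le_mul_self _
  omega

theorem mem_freePairs (n : ℕ) (s : Finset (ℕ × ℕ)) (hs : IsPseudo n s) (p : ℕ × ℕ) :
    p ∈ freePairs n s ↔ p ∉ s ∧ IsPseudo n (insert p s) := by
  have hmem : p ∈ freePairs n s ↔ ((1 ≤ p.1 ∧ p.1 ≤ n) ∧ ∀ q ∈ s, q.1 ≠ p.1 ∧ q.2 ≠ p.1) ∧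
      ((1 ≤ p.2 ∧ p.2 ≤ n) ∧ ∀ q ∈ s, q.1 ≠ p.2 ∧ q.2 ≠ p.2) ∧ p.1 < p.2 := by
    simp only [freePairs, freePos, Finset.mem_filter, Finset.mem_product, Finset.mem_sdiff,
      Finset.mem_Icc, Finset.mem_union, Finset.mem_image, not_or, not_exists, not_and]
    constructor
    · rintro ⟨⟨⟨a, b, c⟩, d, e, f⟩, g⟩
      exact ⟨⟨a, fun q hq => ⟨b q hq, c q hq⟩⟩, ⟨d, fun q hq => ⟨e q hq, f q hq⟩⟩, g⟩
    · rintro ⟨⟨a, b⟩, ⟨d, e⟩, g⟩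
      exact ⟨⟨⟨a, fun q hq => (b q hq).1, fun q hq => (b q hq).2⟩,
        d, fun q hq => (e q hq).1, fun q hq => (e q hq).2⟩, g⟩
  rw [hmem]
  obtain ⟨h1, h2⟩ := hs
  constructor
  · rintro ⟨⟨a, b⟩, ⟨d, e⟩, g⟩
    refine ⟨fun hp => (b p hp).1 rfl, ?_, ?_⟩
    · intro q hq
      rcases Finset.mem_insert.1 hq with rfl | hq
      · exact ⟨a.1, g, d.2⟩
      · exact h1 q hq
    · intro q hq r hr hne
      rcases Finset.mem_insert.1 hq with rfl | hqs
      · rcases Finset.mem_insert.1 hr with rfl | hr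
        · exact absurd rfl hne
        · exact ⟨(b r hr).1.symm, (b r hr).2.symm, (e r hr).1.symm, (e r hr).2.symm⟩
      · rcases Finset.mem_insert.1 hr with rfl | hr
        · exact ⟨(b q hqs).1, (e q hqs).1, (b q hqs).2, (e q hqs).2⟩
        · exact h2 q hqs r hr hne
  · rintro ⟨hp, k1, k2⟩
    have k := k1 p (Finset.mem_insert_self p s)
    have key : ∀ q ∈ s, q.1 ≠ p.1 ∧ q.1 ≠ p.2 ∧ q.2 ≠ p.1 ∧ q.2 ≠ p.2 := fun q hq =>
      k2 q (Finset.mem_insert_of_mem hq) p (Finset.mem_insert_self p s)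
        (fun e => hp (e ▸ hq))
    exact ⟨⟨⟨k.1, by omega⟩, fun q hq => ⟨(key q hq).1, (key q hq).2.2.1⟩⟩,
      ⟨⟨by omega, k.2.2⟩, fun q hq => ⟨(key q hq).2.1, (key q hq).2.2.2⟩⟩, k.2.1⟩

theorem dg_eq (n : ℕ) (s : Finset (ℕ × ℕ)) (hs : IsPseudo n s) :
    dg n s = (freePairs n s).card + s.card := by
  have e : {t : Finset (ℕ × ℕ) | IsPseudo n t ∧ Neighbor s t} =
      (((freePairs n s).image (fun p => insert p s) ∪ s.image (fun p => s.erase p) :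
        Finset (Finset (ℕ × ℕ))) : Set (Finset (ℕ × ℕ))) := by
    ext t
    simp only [Set.mem_ofPred_eq, Finset.coe_union, Finset.coe_image, Set.mem_union,
      Set.mem_image, Finset.mem_coe, Neighbor]
    constructor
    · rintro ⟨ht, ⟨p, hp, rfl⟩ | ⟨p, hp, rfl⟩⟩
      · exact Or.inl ⟨p, (mem_freePairs n s hs p).2 ⟨hp, ht⟩, rfl⟩
      · exact Or.inr ⟨p, hp, rfl⟩
    · rintro (⟨p, hp, rfl⟩ | ⟨p, hp, rfl⟩)
      · have := (mem_freePairs n s hs p).1 hp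
        exact ⟨this.2, Or.inl ⟨p, this.1, rfl⟩⟩
      · exact ⟨⟨fun q hq => hs.1 q (Finset.mem_of_mem_erase hq),
          fun q hq r hr => hs.2 q (Finset.mem_of_mem_erase hq) r (Finset.mem_of_mem_erase hr)⟩,
          Or.inr ⟨p, hp, rfl⟩⟩
  unfold dg
  rw [e, Set.ncard_coe_finset, Finset.card_union_of_disjoint, Finset.card_image_of_injOn,
    Finset.card_image_of_injOn]
  · intro p hp q hq he
    by_contra hne
    have : p ∈ s.erase q := Finset.mem_erase.2 ⟨hne, hp⟩
    rw [← show s.erase p = s.erase q from he] at this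
    exact Finset.notMem_erase p s this
  · intro p hp q hq he
    have hp' := ((mem_freePairs n s hs p).1 hp).1
    have : p ∈ insert q s := by
      rw [← show insert p s = insert q s from he]
      exact Finset.mem_insert_self p s
    rcases Finset.mem_insert.1 this with h | h
    · exact h
    · exact absurd h hp'
  · rw [Finset.disjoint_left]
    intro t hx hy
    obtain ⟨p, hp, rfl⟩ := Finset.mem_image.1 hx
    obtain ⟨q, hq, he⟩ := Finset.mem_image.1 hy
    have hp' := ((mem_freePairs n s hs p).1 hp).1
    apply hp'
    apply Finset.mem_of_mem_erase (a := q)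
    rw [show s.erase q = insert p s from he]
    exact Finset.mem_insert_self p s

theorem stmt_8 (n : ℕ) (s t : Finset (ℕ × ℕ)) (hs : IsPseudo n s)
    (ht : IsPseudo n t) (h : s.card < t.card) :
    (¬ (t.card - s.card = 1 ∧ 2 * t.card = n) → dg n s > dg n t) ∧
    ((t.card - s.card = 1 ∧ 2 * t.card = n) → dg n s = dg n t) := by
  have es := dg_eq n s hs
  have et := dg_eq n t ht
  have fs := card_freePos n s hs
  have ft := card_freePos n t ht
  have gs : 2 * (freePairs n s).card + _ = _ := card_ltPairs (freePos n s)
  have gt : 2 * (freePairs n t).card + _ = _ := card_ltPairs (freePos n t)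
  obtain ⟨k, hk⟩ := Nat.exists_eq_add_of_lt h
  rw [es, et]
  generalize (freePairs n s).card = A at *
  generalize (freePairs n t).card = B at *
  generalize (freePos n s).card = a at *
  generalize (freePos n t).card = b at *
  generalize s.card = x at *
  generalize t.card = y at *
  clear es et
  obtain rfl : a = b + 2 * (k + 1) := by omega
  subst hk
  have key : A = B + (k + 1) * (2 * b + 2 * k + 1) := by nlinarith
  constructor
  · intro hn
    have : 0 < b + k := by omega
    rw [key]
    nlinarith
  · rintro ⟨h1, h2⟩
    obtain rfl : k = 0 := by omega
    obtain rfl : b = 0 := by omega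
    omega
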